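/- arXiv:1406.3336 — 2 statements merged into one kernel-verified Lean document; each statement's English description precedes it below -/
import Mathlib

section
/- For 0 < α < 1, the Mainardi function satisfies ∫₀^∞ M_α(r) dr = 1. -/
open Real MeasureTheory

/-- The Mainardi (Wright-type) function. -/
noncomputable def mainardi (α r : ℝ) : ℝ :=
  ∑' n : ℕ, (-r) ^ n / (n.factorial * Real.Gamma (-α * n + 1 - α))

theorem integrableOn_rpow_mul_exp_neg_mul {a c : ℝ} (ha : 0 < a) (hc : 0 < c) :
    IntegrableOn (fun t : ℝ => t ^ (a - 1) * Real.exp (-(c * t))) (Set.Ioi 0) := by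
  simpa using integrableOn_rpow_mul_exp_neg_mul_rpow (p := 1) (s := a - 1) (by linarith) one_pos hc

theorem norm_rpow_mul_cexp {t : ℝ} (ht : 0 < t) (a : ℝ) (z : ℂ) :
    ‖((t ^ (a - 1) : ℝ) : ℂ) * Complex.exp (-(z * t))‖ = t ^ (a - 1) * Real.exp (-(z.re * t)) := by
  rw [norm_mul, Complex.norm_exp, Complex.norm_real, Real.norm_of_nonneg (by positivity)]
  simp

theorem integrableOn_rpow_mul_cexp_neg_mul {a : ℝ} {z : ℂ} (ha : 0 < a) (hz : 0 < z.re) :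
    IntegrableOn (fun t : ℝ => ((t ^ (a - 1) : ℝ) : ℂ) * Complex.exp (-(z * t))) (Set.Ioi 0) := by
  refine Integrable.mono' (integrableOn_rpow_mul_exp_neg_mul ha hz)
    (Measurable.aestronglyMeasurable (by fun_prop)) ?_
  filter_upwards [ae_restrict_mem measurableSet_Ioi] with t ht
  exact (norm_rpow_mul_cexp ht a z).le

theorem differentiableAt_integral_rpow_mul_cexp {a : ℝ} {z : ℂ} (ha : 0 < a) (hz : 0 < z.re) :
    DifferentiableAt ℂ (fun w : ℂ => ∫ t in Set.Ioi (0 : ℝ), ((t ^ (a - 1) : ℝ) : ℂ) *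
      Complex.exp (-(w * t))) z := by
  have hs : {w : ℂ | z.re / 2 < w.re} ∈ nhds z :=
    (isOpen_lt continuous_const Complex.continuous_re).mem_nhds (by simp; linarith)
  refine (hasDerivAt_integral_of_dominated_loc_of_deriv_le (s := {w : ℂ | z.re / 2 < w.re})
    (F := fun w t => ((t ^ (a - 1) : ℝ) : ℂ) * Complex.exp (-(w * t)))
    (μ := volume.restrict (Set.Ioi 0))
    (F' := fun w t => ((t ^ (a - 1) : ℝ) : ℂ) * (Complex.exp (-(w * t)) * (-t)))
    (bound := fun t => t ^ (a + 1 - 1) * Real.exp (-(z.re / 2 * t))) hs ?_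
    (integrableOn_rpow_mul_cexp_neg_mul ha hz) ?_ ?_ ?_ ?_).2.differentiableAt
  · exact Filter.Eventually.of_forall fun w => Measurable.aestronglyMeasurable (by fun_prop)
  · exact Measurable.aestronglyMeasurable (by fun_prop)
  · filter_upwards [ae_restrict_mem measurableSet_Ioi] with t ht w hw
    have ht' : 0 < t := ht
    have hw' : z.re / 2 < w.re := hw
    rw [← mul_assoc, norm_mul, norm_rpow_mul_cexp ht, norm_neg, Complex.norm_real,
      Real.norm_of_nonneg ht'.le, mul_right_comm, ← rpow_add_one ht'.ne']
    rw [show a - 1 + 1 = a + 1 - 1 by ring]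
    gcongr
  · exact integrableOn_rpow_mul_exp_neg_mul (by linarith) (by linarith)
  · filter_upwards with t w _
    have : HasDerivAt (fun w : ℂ => -(w * t)) (-(t : ℂ)) w := by
      simpa using! ((hasDerivAt_id w).mul_const (t : ℂ)).neg
    exact this.cexp.const_mul _

/-- The Euler integral with a complex rate of decay. -/
theorem integral_rpow_mul_cexp_neg_mul {a : ℝ} {z : ℂ} (ha : 0 < a) (hz : 0 < z.re) :
    ∫ t in Set.Ioi (0 : ℝ), ((t ^ (a - 1) : ℝ) : ℂ) * Complex.exp (-(z * t)) =
      z ^ (-a : ℂ) * Gamma a := by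
  set U : Set ℂ := {w : ℂ | 0 < w.re}
  have hU : IsOpen U := isOpen_lt continuous_const Complex.continuous_re
  have hl : AnalyticOnNhd ℂ (fun w : ℂ => ∫ t in Set.Ioi (0 : ℝ), ((t ^ (a - 1) : ℝ) : ℂ) *
      Complex.exp (-(w * t))) U :=
    DifferentiableOn.analyticOnNhd
      (fun w hw => (differentiableAt_integral_rpow_mul_cexp ha hw).differentiableWithinAt) hU
  have hr : AnalyticOnNhd ℂ (fun w : ℂ => w ^ (-a : ℂ) * Gamma a) U := by
    refine DifferentiableOn.analyticOnNhd (fun w hw => ?_) hU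
    exact ((differentiableAt_id.cpow_const (Or.inl hw)).mul_const _).differentiableWithinAt
  have hpos : ∀ᶠ x : ℝ in nhdsWithin 1 {1}ᶜ, ∫ t in Set.Ioi (0 : ℝ), ((t ^ (a - 1) : ℝ) : ℂ) *
      Complex.exp (-((x : ℂ) * t)) = (x : ℂ) ^ (-a : ℂ) * Gamma a := by
    filter_upwards [nhdsWithin_le_nhds (lt_mem_nhds one_pos)] with x hx
    have h := Real.integral_rpow_mul_exp_neg_mul_Ioi ha hx
    rw [one_div, inv_rpow hx.le, ← rpow_neg hx.le] at h
    rw [← Complex.ofReal_neg, ← Complex.ofReal_cpow hx.le, ← Complex.ofReal_mul, ← h,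
      ← integral_complex_ofReal]
    simp
  have hmap : Filter.Tendsto (fun x : ℝ => (x : ℂ)) (nhdsWithin 1 {1}ᶜ) (nhdsWithin 1 {1}ᶜ) := by
    refine tendsto_nhdsWithin_iff.2 ⟨?_, ?_⟩
    · exact (Complex.continuous_ofReal.tendsto' 1 1 (by simp)).mono_left nhdsWithin_le_nhds
    · filter_upwards [self_mem_nhdsWithin] with x hx
      simpa using hx
  exact hl.eqOn_of_preconnected_of_frequently_eq hr (convex_halfSpace_re_gt 0).isPreconnected
    (show (1 : ℂ) ∈ U by simp [U]) (hmap.frequently hpos.frequently) hz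

/-- The Euler integral along a ray, in polar form. -/
theorem integral_rpow_mul_cexp_polar {a p φ : ℝ} (ha : 0 < a) (hp : 0 < p)
    (hφ : φ ∈ Set.Ioo (-(π / 2)) (π / 2)) :
    ∫ t in Set.Ioi (0 : ℝ), ((t ^ (a - 1) : ℝ) : ℂ) *
        Complex.exp (-(p * Complex.exp (φ * Complex.I) * t)) =
      ((p ^ (-a) * Gamma a : ℝ) : ℂ) * Complex.exp (-(φ * a * Complex.I)) := by
  have hcos : 0 < Real.cos φ := Real.cos_pos_of_mem_Ioo hφ
  have hre : 0 < ((p : ℂ) * Complex.exp (φ * Complex.I)).re := by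
    rw [Complex.re_ofReal_mul, Complex.exp_ofReal_mul_I_re]; positivity
  have hlog : Complex.log (p * Complex.exp (φ * Complex.I)) = Real.log p + φ * Complex.I := by
    rw [Complex.log_ofReal_mul hp (Complex.exp_ne_zero _), Complex.log_exp]
    · have := hφ.1; simp; linarith [pi_pos]
    · have := hφ.2; simp; linarith [pi_pos]
  rw [integral_rpow_mul_cexp_neg_mul ha hre, Complex.cpow_def_of_ne_zero
    (by simpa using hp.ne'), hlog, Real.rpow_def_of_pos hp]
  push_cast
  rw [show ((Real.log p : ℂ) + φ * Complex.I) * (-a) =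
    Real.log p * (-a) + -(φ * a * Complex.I) by ring, Complex.exp_add]
  ring

theorem exists_mul_rpow_le_add_mul {α c : ℝ} (r : ℝ) (hα : α ∈ Set.Ioo (0 : ℝ) 1) (hc : 0 < c) :
    ∃ C : ℝ, ∀ t > 0, r * t ^ α ≤ C + c * t := by
  obtain ⟨h0, h1⟩ := hα
  obtain ⟨T, hT⟩ := Filter.eventually_atTop.1
    ((tendsto_rpow_atTop (sub_pos.2 h1)).eventually_ge_atTop (|r| / c))
  refine ⟨|r| * |T| ^ α, fun t ht => ?_⟩
  have hr : r * t ^ α ≤ |r| * t ^ α := by gcongr; exact le_abs_self r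
  rcases le_total t T with h | h
  · have : |r| * t ^ α ≤ |r| * |T| ^ α := by gcongr; exact h.trans (le_abs_self T)
    have : 0 < c * t := by positivity
    linarith
  · have h2 : |r| ≤ c * t ^ (1 - α) := by
      have := hT t h
      rwa [div_le_iff₀' hc] at this
    have h3 : |r| * t ^ α ≤ c * t := by
      calc |r| * t ^ α ≤ c * t ^ (1 - α) * t ^ α := by gcongr
        _ = c * t := by rw [mul_assoc, ← rpow_add ht]; simp
    have : 0 ≤ |r| * |T| ^ α := by positivity
    linarith

/-- The reflection formula, solved for the reciprocal Gamma function; it holds at the poles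
because `Real.Gamma` takes the value zero there. -/
theorem inv_Gamma_one_sub {z : ℝ} (hz : 0 < z) :
    (Gamma (1 - z))⁻¹ = Gamma z * Real.sin (π * z) / π := by
  have h := Real.Gamma_mul_Gamma_one_sub z
  have hG := (Real.Gamma_pos_of_pos hz).ne'
  have h' : Gamma (1 - z) = π / Real.sin (π * z) / Gamma z := by
    rw [← h]; field_simp
  rw [h', inv_div, div_div_eq_mul_div]

theorem integrableOn_rpow_mul_exp_add_rpow {α b c : ℝ} (r : ℝ) (hα : α ∈ Set.Ioo (0 : ℝ) 1)
    (hb : 0 < b) (hc : 0 < c) :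
    IntegrableOn (fun t : ℝ => t ^ (b - 1) * Real.exp (-(c * t)) * Real.exp (r * t ^ α))
      (Set.Ioi 0) := by
  obtain ⟨C, hC⟩ := exists_mul_rpow_le_add_mul r hα (half_pos hc)
  have hint := integrableOn_rpow_mul_exp_neg_mul hb (half_pos hc)
  refine Integrable.mono' (hint.const_mul (Real.exp C)) ?_ ?_
  · exact Measurable.aestronglyMeasurable (by fun_prop)
  · filter_upwards [ae_restrict_mem measurableSet_Ioi] with t ht
    have ht' : 0 < t := ht
    rw [Real.norm_of_nonneg (by positivity)]
    calc t ^ (b - 1) * Real.exp (-(c * t)) * Real.exp (r * t ^ α)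
        ≤ t ^ (b - 1) * Real.exp (-(c * t)) * Real.exp (C + c / 2 * t) := by
          gcongr; exact hC t ht'
      _ = Real.exp C * (t ^ (b - 1) * Real.exp (-(c / 2 * t))) := by
          rw [mul_assoc, ← Real.exp_add, mul_left_comm, ← Real.exp_add]; ring_nf

/-- The integrand of the Hankel-type representation of the Wright function. -/
noncomputable def wrightKernel (α ψ b r t : ℝ) : ℂ :=
  ((t ^ (b - 1) : ℝ) : ℂ) * Complex.exp (-(Complex.exp ((-ψ : ℝ) * Complex.I) * t)) *
    Complex.exp (-(((t ^ α : ℝ) : ℂ) * Complex.exp (ψ * Complex.I) * r))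

theorem norm_wrightKernel {t : ℝ} (ht : 0 < t) (α ψ b r : ℝ) :
    ‖wrightKernel α ψ b r t‖ =
      t ^ (b - 1) * Real.exp (-(Real.cos ψ * t)) * Real.exp (-(t ^ α * Real.cos ψ * r)) := by
  rw [wrightKernel, norm_mul, norm_rpow_mul_cexp ht, Complex.exp_ofReal_mul_I_re, Complex.norm_exp,
    Real.cos_neg]
  congr 2
  rw [Complex.neg_re, Complex.re_mul_ofReal, Complex.re_ofReal_mul, Complex.exp_ofReal_mul_I_re]

theorem hasSum_integral_wrightKernel {α ψ b : ℝ} (r : ℝ) (hα : α ∈ Set.Ioo (0 : ℝ) 1)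
    (hψ : ψ ∈ Set.Ioo 0 (π / 2)) (hψα : α * (π - ψ) = ψ) (hb : 0 < b) :
    HasSum (fun n : ℕ => (((-r) ^ n / n.factorial * Gamma (b + α * n) : ℝ) : ℂ) *
        Complex.exp ((π * (b + α * n) : ℝ) * Complex.I))
      (Complex.exp (((π - ψ) * b : ℝ) * Complex.I) *
        ∫ t in Set.Ioi (0 : ℝ), wrightKernel α ψ b r t) := by
  have hcos : 0 < Real.cos ψ := Real.cos_pos_of_mem_Ioo ⟨by linarith [hψ.1, pi_pos], hψ.2⟩
  have hmem : -ψ ∈ Set.Ioo (-(π / 2)) (π / 2) :=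
    ⟨by linarith [hψ.2], by linarith [hψ.1, pi_pos]⟩
  let F : ℕ → ℝ → ℂ := fun n t =>
    ((-r) * Complex.exp (ψ * Complex.I)) ^ n / n.factorial *
      (((t ^ (b + α * n - 1) : ℝ) : ℂ) *
        Complex.exp (-((1 : ℝ) * Complex.exp ((-ψ : ℝ) * Complex.I) * t)))
  let bound : ℕ → ℝ → ℝ := fun n t =>
    t ^ (b - 1) * Real.exp (-(Real.cos ψ * t)) * ((|r| * t ^ α) ^ n / n.factorial)
  have hpow : ∀ (n : ℕ) {t : ℝ}, 0 < t → t ^ (b + α * n - 1) = t ^ (b - 1) * (t ^ α) ^ n := by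
    intro n t ht
    rw [← rpow_natCast, ← rpow_mul ht.le, ← rpow_add ht]
    ring_nf
  have hbsum : ∀ t, HasSum (bound · t)
      (t ^ (b - 1) * Real.exp (-(Real.cos ψ * t)) * Real.exp (|r| * t ^ α)) := by
    intro t
    rw [show Real.exp (|r| * t ^ α) = NormedSpace.exp (|r| * t ^ α) by rw [Real.exp_eq_exp_ℝ]]
    exact (NormedSpace.expSeries_div_hasSum_exp (|r| * t ^ α)).mul_left _
  have hsum : HasSum (fun n => ∫ t in Set.Ioi (0 : ℝ), F n t)
      (∫ t in Set.Ioi (0 : ℝ), wrightKernel α ψ b r t) := by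
    refine hasSum_integral_of_dominated_convergence bound ?_ ?_ ?_ ?_ ?_
    · exact fun n => Measurable.aestronglyMeasurable (by fun_prop)
    · intro n
      filter_upwards [ae_restrict_mem measurableSet_Ioi] with t ht
      have ht' : 0 < t := ht
      simp only [F, bound, Complex.ofReal_one, one_mul]
      rw [norm_mul, norm_rpow_mul_cexp ht', Complex.exp_ofReal_mul_I_re, Real.cos_neg, hpow n ht',
        norm_div, norm_pow, norm_mul, Complex.norm_exp_ofReal_mul_I, norm_neg, Complex.norm_real,
        Complex.norm_natCast, mul_pow, Real.norm_eq_abs]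
      apply le_of_eq
      ring
    · exact Filter.Eventually.of_forall fun t => (hbsum t).summable
    · simp_rw [fun t => (hbsum t).tsum_eq]
      exact integrableOn_rpow_mul_exp_add_rpow _ hα hb hcos
    · filter_upwards [ae_restrict_mem measurableSet_Ioi] with t ht
      have ht' : 0 < t := ht
      have h := (NormedSpace.expSeries_div_hasSum_exp
        (-(((t ^ α : ℝ) : ℂ) * Complex.exp (ψ * Complex.I) * r))).mul_left
        (((t ^ (b - 1) : ℝ) : ℂ) * Complex.exp (-(Complex.exp ((-ψ : ℝ) * Complex.I) * t)))
      rw [← Complex.exp_eq_exp_ℂ] at h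
      convert! h using 1
      funext n
      simp only [F]
      rw [hpow n ht']
      push_cast
      ring_nf
  convert! hsum.mul_left _ using 1
  funext n
  simp only [F]
  rw [integral_const_mul, integral_rpow_mul_cexp_polar (by have := hα.1; positivity) one_pos hmem,
    one_rpow, one_mul, mul_pow, ← Complex.exp_nat_mul]
  have harg : ((π * (b + α * n) : ℝ) : ℂ) * Complex.I = ((π - ψ) * b : ℝ) * Complex.I +
      (n * (ψ * Complex.I) + -((-ψ : ℝ) * (b + α * n : ℝ) * Complex.I)) := by
    have : ((α * (π - ψ) : ℝ) : ℂ) = ψ := by rw [hψα]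
    push_cast at this ⊢
    linear_combination (n * Complex.I : ℂ) * this
  rw [harg, Complex.exp_add, Complex.exp_add]
  push_cast
  ring

theorem integrable_rpow_mul_wrightKernel {α ψ b s : ℝ} (hψ : ψ ∈ Set.Ioo 0 (π / 2)) (hs : 0 < s)
    (hsb : α * s < b) :
    Integrable (Function.uncurry fun r t : ℝ => ((r ^ (s - 1) : ℝ) : ℂ) * wrightKernel α ψ b r t)
      ((volume.restrict (Set.Ioi 0)).prod (volume.restrict (Set.Ioi 0))) := by
  have hcos : 0 < Real.cos ψ := Real.cos_pos_of_mem_Ioo ⟨by linarith [hψ.1, pi_pos], hψ.2⟩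
  have hnorm : ∀ t > 0, ∀ r > 0, ‖((r ^ (s - 1) : ℝ) : ℂ) * wrightKernel α ψ b r t‖ =
      t ^ (b - 1) * Real.exp (-(Real.cos ψ * t)) *
        (r ^ (s - 1) * Real.exp (-(t ^ α * Real.cos ψ * r))) := by
    intro t ht r hr
    rw [norm_mul, norm_wrightKernel ht, Complex.norm_real, Real.norm_of_nonneg (by positivity)]
    ring
  have hmeas : Measurable
      (Function.uncurry fun r t : ℝ => ((r ^ (s - 1) : ℝ) : ℂ) * wrightKernel α ψ b r t) := by
    unfold wrightKernel Function.uncurry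
    fun_prop
  refine (integrable_prod_iff' hmeas.aestronglyMeasurable).2 ⟨?_, ?_⟩
  · filter_upwards [ae_restrict_mem measurableSet_Ioi] with t ht
    have ht' : 0 < t := ht
    refine Integrable.mono' ((integrableOn_rpow_mul_exp_neg_mul hs
      (mul_pos (rpow_pos_of_pos ht' α) hcos)).const_mul
        (t ^ (b - 1) * Real.exp (-(Real.cos ψ * t))))
      (hmeas.comp measurable_prodMk_right).aestronglyMeasurable ?_
    filter_upwards [ae_restrict_mem measurableSet_Ioi] with r hr
    exact (hnorm t ht r hr).le
  · refine ((integrableOn_rpow_mul_exp_neg_mul (sub_pos.2 hsb) hcos).const_mul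
      (Real.cos ψ ^ (-s) * Gamma s)).congr ?_
    filter_upwards [ae_restrict_mem measurableSet_Ioi] with t ht
    have ht' : 0 < t := ht
    have hp : 0 < t ^ α * Real.cos ψ := by positivity
    simp only [Function.uncurry]
    rw [setIntegral_congr_fun measurableSet_Ioi (hnorm t ht'), integral_const_mul,
      Real.integral_rpow_mul_exp_neg_mul_Ioi hs hp, one_div, inv_rpow hp.le, ← rpow_neg hp.le,
      mul_rpow (by positivity) hcos.le, ← rpow_mul ht'.le,
      show b - α * s - 1 = (b - 1) + α * -s by ring, rpow_add ht']
    ring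

theorem integral_integral_rpow_mul_wrightKernel {α ψ b s : ℝ}
    (hψ : ψ ∈ Set.Ioo 0 (π / 2)) (hψα : α * (π - ψ) = ψ) (hs : 0 < s) (hsb : α * s < b) :
    Complex.exp (((π - ψ) * b : ℝ) * Complex.I) *
        ∫ r in Set.Ioi (0 : ℝ), ∫ t in Set.Ioi (0 : ℝ),
          ((r ^ (s - 1) : ℝ) : ℂ) * wrightKernel α ψ b r t =
      ((Gamma s * Gamma (b - α * s) : ℝ) : ℂ) *
        Complex.exp ((π * (b - α * s) : ℝ) * Complex.I) := by
  have hmem : -ψ ∈ Set.Ioo (-(π / 2)) (π / 2) :=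
    ⟨by linarith [hψ.2], by linarith [hψ.1, pi_pos]⟩
  have hmem' : ψ ∈ Set.Ioo (-(π / 2)) (π / 2) := ⟨by linarith [hψ.1, pi_pos], hψ.2⟩
  rw [integral_integral_swap (integrable_rpow_mul_wrightKernel hψ hs hsb)]
  have hinner : ∀ t ∈ Set.Ioi (0 : ℝ), ∫ r in Set.Ioi (0 : ℝ),
      ((r ^ (s - 1) : ℝ) : ℂ) * wrightKernel α ψ b r t =
      (Gamma s * Complex.exp (-(ψ * s * Complex.I))) * (((t ^ (b - α * s - 1) : ℝ) : ℂ) *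
        Complex.exp (-((1 : ℝ) * Complex.exp ((-ψ : ℝ) * Complex.I) * t))) := by
    intro t ht
    have ht' : 0 < t := ht
    have hcomm : ∀ r : ℝ, ((r ^ (s - 1) : ℝ) : ℂ) * wrightKernel α ψ b r t =
        (((t ^ (b - 1) : ℝ) : ℂ) * Complex.exp (-(Complex.exp ((-ψ : ℝ) * Complex.I) * t))) *
        (((r ^ (s - 1) : ℝ) : ℂ) *
          Complex.exp (-(((t ^ α : ℝ) : ℂ) * Complex.exp (ψ * Complex.I) * r))) := by
      intro r
      rw [wrightKernel]
      ring
    simp_rw [hcomm]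
    rw [integral_const_mul, integral_rpow_mul_cexp_polar hs (rpow_pos_of_pos ht' α) hmem',
      ← rpow_mul ht'.le, show b - α * s - 1 = (b - 1) + α * -s by ring, rpow_add ht']
    push_cast
    ring_nf
  rw [setIntegral_congr_fun measurableSet_Ioi hinner, integral_const_mul,
    integral_rpow_mul_cexp_polar (sub_pos.2 hsb) one_pos hmem, one_rpow, one_mul]
  have harg : ((π * (b - α * s) : ℝ) : ℂ) * Complex.I = ((π - ψ) * b : ℝ) * Complex.I +
      (-(ψ * s * Complex.I) + -((-ψ : ℝ) * (b - α * s : ℝ) * Complex.I)) := by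
    have : ((α * (π - ψ) : ℝ) : ℂ) = ψ := by rw [hψα]
    push_cast at this ⊢
    linear_combination (-s * Complex.I : ℂ) * this
  rw [harg, Complex.exp_add, Complex.exp_add]
  push_cast
  ring

theorem exists_hankel_angle {α : ℝ} (hα : α ∈ Set.Ioo (0 : ℝ) 1) :
    ∃ ψ ∈ Set.Ioo 0 (π / 2), α * (π - ψ) = ψ := by
  obtain ⟨h0, h1⟩ := hα
  have hpi := pi_pos
  refine ⟨π * α / (1 + α), ⟨by positivity, ?_⟩, ?_⟩
  · rw [div_lt_div_iff₀ (by positivity) two_pos]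
    nlinarith
  · field_simp
    ring

/-- The Wright function `∑ (-r)ⁿ / (n! Γ(1 - b - αn))`, with the reciprocal Gamma factors written
through the reflection formula. -/
noncomputable def wright (α b r : ℝ) : ℝ :=
  ∑' n : ℕ, (-r) ^ n / n.factorial * (Gamma (b + α * n) * Real.sin (π * (b + α * n)) / π)

theorem wright_eq_im {α ψ b : ℝ} (r : ℝ) (hα : α ∈ Set.Ioo (0 : ℝ) 1)
    (hψ : ψ ∈ Set.Ioo 0 (π / 2)) (hψα : α * (π - ψ) = ψ) (hb : 0 < b) :
    wright α b r = (Complex.exp (((π - ψ) * b : ℝ) * Complex.I) *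
        ∫ t in Set.Ioi (0 : ℝ), wrightKernel α ψ b r t).im / π := by
  have h := (Complex.hasSum_im (hasSum_integral_wrightKernel r hα hψ hψα hb)).div_const π
  rw [← h.tsum_eq, wright]
  refine tsum_congr fun n => ?_
  rw [Complex.im_ofReal_mul, Complex.exp_ofReal_mul_I_im]
  ring

/-- The Mellin transform of the Wright function. -/
theorem mellin_wright {α b s : ℝ} (hα : α ∈ Set.Ioo (0 : ℝ) 1) (hs : 0 < s) (hsb : α * s < b) :
    IntegrableOn (fun r => r ^ (s - 1) * wright α b r) (Set.Ioi 0) ∧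
      ∫ r in Set.Ioi (0 : ℝ), r ^ (s - 1) * wright α b r =
        Gamma s * (Gamma (b - α * s) * Real.sin (π * (b - α * s)) / π) := by
  obtain ⟨ψ, hψ, hψα⟩ := exists_hankel_angle hα
  have hb : 0 < b := (mul_pos hα.1 hs).trans hsb
  have hint := ((integrable_rpow_mul_wrightKernel hψ hs hsb).integral_prod_left.const_mul
    (Complex.exp (((π - ψ) * b : ℝ) * Complex.I)))
  have heq : ∀ r : ℝ, r ^ (s - 1) * wright α b r =
      (Complex.exp (((π - ψ) * b : ℝ) * Complex.I) * ∫ t in Set.Ioi (0 : ℝ),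
        ((r ^ (s - 1) : ℝ) : ℂ) * wrightKernel α ψ b r t).im / π := by
    intro r
    rw [wright_eq_im r hα hψ hψα hb, integral_const_mul, mul_left_comm, Complex.im_ofReal_mul,
      mul_div_assoc]
  have him := integral_im hint
  simp_rw [heq]
  refine ⟨hint.im.div_const π, ?_⟩
  rw [integral_div]
  refine (congrArg (· / π) him).trans ?_
  simp only [Function.uncurry]
  rw [integral_const_mul, integral_integral_rpow_mul_wrightKernel hψ hψα hs hsb]
  simp only [RCLike.im_to_complex]
  rw [Complex.im_ofReal_mul, Complex.exp_ofReal_mul_I_im]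
  ring

theorem mainardi_eq_wright {α : ℝ} (hα : 0 < α) (r : ℝ) : mainardi α r = wright α α r := by
  refine tsum_congr fun n => ?_
  rw [← inv_Gamma_one_sub (by positivity), show 1 - (α + α * n) = -α * n + 1 - α by ring]
  ring

theorem wright_one_eq_mul_mainardi {α : ℝ} (hα : 0 < α) (r : ℝ) :
    wright α 1 r = α * r * mainardi α r := by
  have hterm : ∀ n : ℕ, Gamma (1 + α * n) * Real.sin (π * (1 + α * n)) / π =
      (Gamma (-(α * n)))⁻¹ := by
    intro n
    rw [← inv_Gamma_one_sub (by positivity)]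
    ring_nf
  rw [wright, mainardi, ← tsum_mul_left]
  simp_rw [hterm]
  rw [← (Nat.succ_injective).tsum_eq]
  · refine tsum_congr fun n => ?_
    have hne : -(α * ((n : ℝ) + 1)) ≠ 0 := by
      rw [neg_ne_zero]; positivity
    have hn : ((n : ℝ) + 1) ≠ 0 := by positivity
    have hG : Gamma (-α * n + 1 - α) = -(α * ((n : ℝ) + 1)) * Gamma (-(α * ((n : ℝ) + 1))) := by
      rw [← Real.Gamma_add_one hne]; ring_nf
    rw [hG, Nat.succ_eq_add_one, Nat.factorial_succ, pow_succ]
    push_cast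
    field_simp
  · intro n hn
    rcases n with _ | n
    · simp at hn
    · exact ⟨n, rfl⟩

/-- A bound for the Mellin integrands that is uniform in the exponent. -/
theorem norm_rpow_mul_wright_le {α r s : ℝ} (hα : 0 < α) (hr : 0 < r)
    (hs : s ∈ Set.Icc (1 / 2 : ℝ) 1) :
    ‖r ^ (s - 1) * wright α α r‖ ≤
      ‖r ^ ((1 / 2 : ℝ) - 1) * wright α α r‖ + α⁻¹ * ‖r ^ ((1 : ℝ) - 1) * wright α 1 r‖ := by
  have hw : α⁻¹ * ‖r ^ ((1 : ℝ) - 1) * wright α 1 r‖ = r * ‖wright α α r‖ := by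
    rw [wright_one_eq_mul_mainardi hα, mainardi_eq_wright hα, sub_self, rpow_zero, one_mul,
      norm_mul, Real.norm_of_nonneg (by positivity)]
    field_simp
  rw [hw, norm_mul, norm_mul, Real.norm_of_nonneg (rpow_nonneg hr.le _),
    Real.norm_of_nonneg (rpow_nonneg hr.le _), ← add_mul]
  gcongr
  rcases le_total r 1 with h | h
  · have := rpow_le_rpow_of_exponent_ge hr h (by linarith [hs.1] : (1 / 2 : ℝ) - 1 ≤ s - 1)
    linarith
  · have := rpow_le_one_of_one_le_of_nonpos h (by linarith [hs.2] : s - 1 ≤ 0)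
    have : 0 < r ^ ((1 / 2 : ℝ) - 1) := by positivity
    linarith

theorem mainardi_integral_one (α : ℝ) (hα : α ∈ Set.Ioo (0 : ℝ) 1) :
    ∫ r in Set.Ioi (0 : ℝ), mainardi α r = 1 := by
  have h0 := hα.1
  have hhalf := (mellin_wright (b := α) (s := 1 / 2) hα (by norm_num) (by linarith)).1
  have hone := (mellin_wright (b := 1) (s := 1) hα one_pos (by linarith [hα.2])).1
  have hs : ∀ᶠ s : ℝ in nhdsWithin 1 (Set.Iio 1), s ∈ Set.Ioo (1 / 2 : ℝ) 1 :=
    Ioo_mem_nhdsLT (by norm_num)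
  have hmellin := fun (s : ℝ) (h : s ∈ Set.Ioo (1 / 2 : ℝ) 1) =>
    mellin_wright (b := α) (s := s) hα (by linarith [h.1]) (by nlinarith [h.2])
  have hlim : Filter.Tendsto (fun s : ℝ => ∫ r in Set.Ioi (0 : ℝ), r ^ (s - 1) * wright α α r)
      (nhdsWithin 1 (Set.Iio 1)) (nhds (∫ r in Set.Ioi (0 : ℝ), mainardi α r)) := by
    refine tendsto_integral_filter_of_dominated_convergence _ ?_ ?_
      (hhalf.norm.add (hone.norm.const_mul α⁻¹)) ?_
    · filter_upwards [hs] with s h using (hmellin s h).1.aestronglyMeasurable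
    · filter_upwards [hs] with s h
      filter_upwards [ae_restrict_mem measurableSet_Ioi] with r hr
      exact norm_rpow_mul_wright_le h0 hr (Set.Ioo_subset_Icc_self h)
    · filter_upwards [ae_restrict_mem measurableSet_Ioi] with r hr
      have hr' : 0 < r := hr
      have hc : Continuous fun s : ℝ => r ^ (s - 1) * wright α α r :=
        ((continuous_const_rpow hr'.ne').comp (continuous_sub_right 1)).mul_const _
      refine (hc.tendsto' 1 _ ?_).mono_left nhdsWithin_le_nhds
      simp [mainardi_eq_wright h0]
  have hgamma : Filter.Tendsto (fun s : ℝ => Gamma s * (Gamma (1 - (α - α * s)))⁻¹)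
      (nhdsWithin 1 (Set.Iio 1)) (nhds 1) := by
    have hG : ContinuousAt Gamma 1 := 
      (Real.differentiableAt_Gamma fun m => by
        have : (0 : ℝ) ≤ m := m.cast_nonneg
        linarith).continuousAt
    have hG' : ContinuousAt (fun s : ℝ => Gamma (1 - (α - α * s))) 1 :=
      ContinuousAt.comp (g := Gamma) (by simpa using hG) (by fun_prop)
    have h := hG.mul (hG'.inv₀ (by simp))
    simpa using! h.tendsto.mono_left nhdsWithin_le_nhds
  refine tendsto_nhds_unique hlim (hgamma.congr' ?_)
  filter_upwards [hs] with s h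
  rw [(hmellin s h).2, inv_Gamma_one_sub (by nlinarith [h.2])]
end

section
/- For 0 < α < 1 and λ ≥ 0, the Mainardi function satisfies ∫₀^∞ (α / r^{α+1}) M_α(1/r^α) e^{-λr} dr = e^{-λ^α}. -/
open Real MeasureTheory

open Filter Set Topology Asymptotics
open scoped FourierTransform

section Laplace

lemma differentiableOn_integral_mul_exp_neg {g : ℝ → ℂ}
    (hg : ∀ ε : ℝ, 0 < ε → IntegrableOn (fun r ↦ g r * rexp (-(ε * r))) (Ioi 0)) :
    DifferentiableOn ℂ (fun z : ℂ ↦ ∫ r in Ioi (0 : ℝ), g r * Complex.exp (-(z * r)))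
      {z : ℂ | 0 < z.re} := by
  have hmeas : AEStronglyMeasurable g (volume.restrict (Ioi 0)) := by
    have h := (hg 1 one_pos).aestronglyMeasurable.mul
      (Continuous.aestronglyMeasurable (f := fun r : ℝ ↦ ((rexp r : ℝ) : ℂ)) (by fun_prop))
    refine h.congr (ae_of_all _ fun r ↦ ?_)
    simp [mul_assoc, ← Complex.exp_add]
  have hmeasF : ∀ z : ℂ, AEStronglyMeasurable (fun r : ℝ ↦ g r * Complex.exp (-(z * r)))
      (volume.restrict (Ioi 0)) := fun z ↦
    hmeas.mul (Continuous.aestronglyMeasurable (by fun_prop))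
  intro z₀ (hz₀ : 0 < z₀.re)
  set ε := z₀.re / 4 with hε
  have hε0 : 0 < ε := by positivity
  have hs : {z : ℂ | 2 * ε < z.re} ∈ 𝓝 z₀ :=
    (isOpen_lt continuous_const Complex.continuous_re).mem_nhds (by change 2 * ε < z₀.re; linarith)
  refine (hasDerivAt_integral_of_dominated_loc_of_deriv_le
    (F' := fun z (r : ℝ) ↦ g r * (Complex.exp (-(z * r)) * (-r)))
    (bound := fun r ↦ ‖g r * rexp (-(ε * r))‖ / ε) hs (Eventually.of_forall hmeasF) ?_
    (hmeas.mul (Continuous.aestronglyMeasurable (by fun_prop)))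
    ?_ ((hg ε hε0).norm.div_const _) (ae_of_all _ fun r z _ ↦ ?_)).2.differentiableAt.differentiableWithinAt
  · refine Integrable.congr' (hg z₀.re hz₀) (hmeasF z₀) (ae_of_all _ fun r ↦ ?_)
    simp [Complex.norm_exp]
  · refine (ae_restrict_mem measurableSet_Ioi).mono fun r (hr : 0 < r) z (hz : 2 * ε < z.re) ↦ ?_
    simp only [norm_mul, Complex.norm_exp, Complex.neg_re, Complex.re_mul_ofReal, norm_neg,
      Complex.norm_real, Real.norm_eq_abs, Real.abs_exp, abs_of_pos hr]
    rw [mul_div_assoc]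
    gcongr
    rw [le_div_iff₀ hε0]
    have h1 : ε * r ≤ rexp (ε * r) := (by linarith [Real.add_one_le_exp (ε * r)])
    have h2 : rexp (-(z.re * r)) ≤ rexp (-(2 * ε * r)) := by gcongr
    calc rexp (-(z.re * r)) * r * ε = rexp (-(z.re * r)) * (ε * r) := by ring
      _ ≤ rexp (-(2 * ε * r)) * rexp (ε * r) := by gcongr
      _ = rexp (-(ε * r)) := by rw [← Real.exp_add]; ring_nf
  · refine HasDerivAt.const_mul _ ?_
    have h := ((hasDerivAt_id z).mul_const (r : ℂ)).neg.cexp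
    simpa using h

lemma integral_rpow_mul_cexp_neg_mul_s15 {s : ℝ} {w : ℂ} (hs : 0 < s) (hw : 0 < w.re) :
    ∫ t in Ioi (0 : ℝ), ((t ^ (s - 1) : ℝ) : ℂ) * Complex.exp (-(w * t)) =
      (1 / w) ^ (s : ℂ) * Real.Gamma s := by
  have hopen : IsOpen {z : ℂ | 0 < z.re} := isOpen_lt continuous_const Complex.continuous_re
  have hL := differentiableOn_integral_mul_exp_neg (g := fun t ↦ ((t ^ (s - 1) : ℝ) : ℂ))
    fun ε hε ↦ by
      have h := (integrableOn_rpow_mul_exp_neg_mul_rpow (s := s - 1) (by linarith) one_pos hε).ofReal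
        (𝕜 := ℂ)
      refine h.congr (ae_of_all _ fun t ↦ ?_)
      simp
  have hR : DifferentiableOn ℂ (fun z : ℂ ↦ (1 / z) ^ (s : ℂ) * Real.Gamma s)
      {z : ℂ | 0 < z.re} := by
    intro z (hz : 0 < z.re)
    have hz0 : z ≠ 0 := by rintro rfl; simp at hz
    refine DifferentiableAt.differentiableWithinAt ?_
    refine DifferentiableAt.mul_const (DifferentiableAt.cpow_const
      ((differentiableAt_const _).div differentiableAt_id hz0) (Or.inl ?_)) _
    change 0 < (1 / z).re
    rw [one_div, Complex.inv_re]
    exact div_pos hz (Complex.normSq_pos.2 hz0)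
  have hpre : IsPreconnected {z : ℂ | 0 < z.re} :=
    (convex_halfSpace_re_gt 0).isPreconnected
  refine (hL.analyticOnNhd hopen).eqOn_of_preconnected_of_frequently_eq (hR.analyticOnNhd hopen)
    hpre (z₀ := ((1 : ℝ) : ℂ)) (by simp) ?_ hw
  have ht : Tendsto (fun x : ℝ ↦ (x : ℂ)) (𝓝[≠] 1) (𝓝[≠] ((1 : ℝ) : ℂ)) :=
    Complex.continuous_ofReal.continuousWithinAt.tendsto_nhdsWithin
      fun x hx ↦ by simpa using hx
  refine ht.frequently (Eventually.frequently ?_)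
  filter_upwards [nhdsWithin_le_nhds (lt_mem_nhds one_pos)] with x hx
  have h := Real.integral_rpow_mul_exp_neg_mul_Ioi hs hx
  have h' := congrArg (fun y : ℝ ↦ (y : ℂ)) h
  simp only [← integral_complex_ofReal] at h'
  rw [Complex.ofReal_mul, Complex.ofReal_cpow (by positivity)] at h'
  push_cast at h' ⊢
  exact h'

end Laplace

section SeriesExpansion

lemma integrableOn_exp_mul_rpow_mul_exp_neg {α c : ℝ} (B : ℝ) (hα : 0 < α) (hα1 : α < 1)
    (hc : 0 < c) :
    IntegrableOn (fun v : ℝ ↦ rexp (B * v ^ α) * rexp (-(c * v))) (Ioi 0) := by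
  have hcont : Continuous fun v : ℝ ↦ rexp (B * v ^ α) * rexp (-(c * v)) := by
    have : Continuous fun v : ℝ ↦ v ^ α := Real.continuous_rpow_const hα.le
    fun_prop
  refine integrable_of_isBigO_exp_neg (b := c / 2) (by positivity) hcont.continuousOn ?_
  refine IsBigO.of_bound 1 ?_
  have hlim : Tendsto (fun v : ℝ ↦ B * v ^ (-(1 - α))) atTop (𝓝 0) := by
    simpa using (tendsto_rpow_neg_atTop (sub_pos.2 hα1)).const_mul B
  filter_upwards [hlim.eventually (gt_mem_nhds (half_pos hc)), eventually_gt_atTop 0] with v hv hv0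
  rw [one_mul, ← Real.exp_add, Real.norm_eq_abs, Real.norm_eq_abs, Real.abs_exp, Real.abs_exp,
    Real.exp_le_exp]
  have hpow : v ^ α = v ^ (-(1 - α)) * v := by
    rw [← Real.rpow_add_one hv0.ne']; ring_nf
  have := mul_le_mul_of_nonneg_right hv.le hv0.le
  rw [hpow]
  nlinarith

lemma integral_pow_mul_rpow_mul_exp {α : ℝ} {w : ℂ} (b : ℂ) (hα : 0 < α) (hw : 0 < w.re) (n : ℕ) :
    ∫ v in Ioi (0 : ℝ), (-(b * (v ^ α : ℝ))) ^ n / n.factorial * Complex.exp (-(w * v)) =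
      (-b) ^ n / n.factorial * ((1 / w) ^ ((α * n + 1 : ℝ) : ℂ) * Real.Gamma (α * n + 1)) := by
  have hpos : 0 < α * n + 1 := by positivity
  rw [← integral_rpow_mul_cexp_neg_mul_s15 hpos hw, ← integral_const_mul]
  refine setIntegral_congr_fun measurableSet_Ioi fun v hv ↦ ?_
  rw [add_sub_cancel_right, Real.rpow_mul (le_of_lt hv), Real.rpow_natCast, ← neg_mul, mul_pow]
  push_cast
  ring

lemma hasSum_integral_exp_mul_exp_rpow {α : ℝ} {w : ℂ} (b : ℂ) (hα : 0 < α) (hα1 : α < 1)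
    (hw : 0 < w.re) :
    HasSum (fun n : ℕ ↦
        (-b) ^ n / n.factorial * ((1 / w) ^ ((α * n + 1 : ℝ) : ℂ) * Real.Gamma (α * n + 1)))
      (∫ v in Ioi (0 : ℝ), Complex.exp (-(b * (v ^ α : ℝ))) * Complex.exp (-(w * v))) := by
  simp_rw [← integral_pow_mul_rpow_mul_exp b hα hw]
  have hsum : ∀ v : ℝ, HasSum
      (fun n : ℕ ↦ (‖b‖ * v ^ α) ^ n / n.factorial * rexp (-(w.re * v)))
      (rexp (‖b‖ * v ^ α) * rexp (-(w.re * v))) := fun v ↦ by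
    rw [Real.exp_eq_exp_ℝ]
    exact (NormedSpace.exp_series_hasSum_exp' (𝕂 := ℝ) (‖b‖ * v ^ α)).mul_right _ |>.congr_fun
      (fun n ↦ by simp [div_eq_inv_mul])
  have hcont : Continuous fun v : ℝ ↦ v ^ α := Real.continuous_rpow_const hα.le
  refine hasSum_integral_of_dominated_convergence
    (fun n v ↦ (‖b‖ * v ^ α) ^ n / n.factorial * rexp (-(w.re * v))) (fun n ↦ ?_) (fun n ↦ ?_)
    (ae_of_all _ fun v ↦ (hsum v).summable) ?_ (ae_of_all _ fun v ↦ ?_)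
  · refine Continuous.aestronglyMeasurable ?_
    fun_prop
  · refine (ae_restrict_mem measurableSet_Ioi).mono fun v hv ↦ le_of_eq ?_
    have hv0 : 0 ≤ v ^ α := Real.rpow_nonneg (le_of_lt hv) _
    simp [Complex.norm_exp, abs_of_nonneg hv0]
  · simp_rw [(hsum _).tsum_eq]
    exact integrableOn_exp_mul_rpow_mul_exp_neg _ hα hα1 hw
  · refine HasSum.mul_right _ ?_
    rw [Complex.exp_eq_exp_ℂ]
    exact (NormedSpace.exp_series_hasSum_exp' (𝕂 := ℂ) (-(b * (v ^ α : ℝ)))).congr_fun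
      (fun n ↦ by simp [div_eq_inv_mul])

lemma inv_exp_cpow_ofReal {ζ : ℂ} (h1 : -π < ζ.im) (h2 : ζ.im < π) (s : ℝ) :
    (1 / Complex.exp ζ) ^ (s : ℂ) = Complex.exp (-(ζ * s)) := by
  rw [one_div, ← Complex.exp_neg, Complex.cpow_def_of_ne_zero (Complex.exp_ne_zero _),
    Complex.log_exp (by simpa using h2) (by simp; linarith), neg_mul]

end SeriesExpansion

/-- The integral of `exp (r s - s ^ α)` over the ray of argument `ψ`. -/
noncomputable def rayIntegral (α r ψ : ℝ) : ℂ :=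
  Complex.exp (ψ * Complex.I) * ∫ v in Ioi (0 : ℝ),
    Complex.exp (-(Complex.exp ((α * ψ : ℝ) * Complex.I) * (v ^ α : ℝ))) *
      Complex.exp (-(-(r * Complex.exp (ψ * Complex.I)) * v))

lemma hasSum_rayIntegral_im {α r ρ ψ κ : ℝ} (hα : 0 < α) (hα1 : α < 1) (hρ : 0 < ρ)
    (hr : (r : ℂ) * Complex.exp (κ * Complex.I) = -ρ)
    (h1 : -(π / 2) < ψ - κ) (h2 : ψ - κ < π / 2) :
    HasSum (fun n : ℕ ↦ (-1) ^ n / n.factorial * Real.Gamma (α * n + 1) *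
      ρ ^ (-(α * n + 1)) * Real.sin (κ * (α * n + 1))) (rayIntegral α r ψ).im := by
  have hπ := Real.pi_pos
  set ζ : ℂ := (Real.log ρ : ℝ) + ((ψ - κ : ℝ) : ℂ) * Complex.I with hζ
  have hζim : ζ.im = ψ - κ := by simp [hζ]
  have hexp : -(r * Complex.exp (ψ * Complex.I)) = Complex.exp ζ := by
    rw [hζ, Complex.exp_add, ← Complex.ofReal_exp, Real.exp_log hρ, ← neg_neg (ρ : ℂ), ← hr]
    have : Complex.exp (ψ * Complex.I) =
        Complex.exp (κ * Complex.I) * Complex.exp (((ψ - κ : ℝ) : ℂ) * Complex.I) := by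
      rw [← Complex.exp_add]; push_cast; ring_nf
    rw [this]; ring
  have hre : 0 < (Complex.exp ζ).re := by
    rw [Complex.exp_re, hζim]
    exact mul_pos (Real.exp_pos _) (Real.cos_pos_of_mem_Ioo ⟨h1, h2⟩)
  have hsum := (hasSum_integral_exp_mul_exp_rpow (Complex.exp ((α * ψ : ℝ) * Complex.I))
    hα hα1 hre).mul_left (Complex.exp (ψ * Complex.I))
  rw [← hexp] at hsum
  refine (Complex.hasSum_im hsum).congr_fun fun n ↦ ?_
  rw [hexp, inv_exp_cpow_ofReal (by linarith) (by linarith), neg_pow (Complex.exp _),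
    ← Complex.exp_nat_mul]
  have hterm : Complex.exp (ψ * Complex.I) *
      ((-1) ^ n * Complex.exp (n * ((α * ψ : ℝ) * Complex.I)) / n.factorial *
        (Complex.exp (-(ζ * (α * n + 1 : ℝ))) * Real.Gamma (α * n + 1))) =
      (((-1) ^ n / n.factorial * Real.Gamma (α * n + 1) * ρ ^ (-(α * n + 1)) : ℝ) : ℂ) *
        Complex.exp ((κ * (α * n + 1) : ℝ) * Complex.I) := by
    have h : Complex.exp (ψ * Complex.I) * Complex.exp (n * ((α * ψ : ℝ) * Complex.I)) *
        Complex.exp (-(ζ * (α * n + 1 : ℝ))) =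
        ((ρ ^ (-(α * n + 1)) : ℝ) : ℂ) * Complex.exp ((κ * (α * n + 1) : ℝ) * Complex.I) := by
      rw [Real.rpow_def_of_pos hρ, Complex.ofReal_exp, ← Complex.exp_add, ← Complex.exp_add,
        ← Complex.exp_add, hζ]
      push_cast
      ring_nf
    push_cast at h ⊢
    linear_combination ((-1) ^ n / n.factorial * (Real.Gamma (α * n + 1) : ℂ)) * h
  rw [hterm, Complex.im_ofReal_mul, Complex.exp_ofReal_mul_I_im]

lemma rayIntegral_im_of_neg {α r ψ : ℝ} (hα : 0 < α) (hα1 : α < 1) (hr : r < 0)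
    (h1 : -(π / 2) < ψ) (h2 : ψ < π / 2) : (rayIntegral α r ψ).im = 0 := by
  have h := hasSum_rayIntegral_im (r := r) (ρ := -r) (ψ := ψ) (κ := 0) hα hα1 (by linarith)
    (by simp) (by simpa using h1) (by simpa using h2)
  exact h.unique (by simp)

lemma one_div_Gamma_one_sub {s : ℝ} (hs : 0 < s) :
    1 / Real.Gamma (1 - s) = Real.Gamma s * Real.sin (π * s) / π := by
  have h := Real.Gamma_mul_Gamma_one_sub s
  have hG := (Real.Gamma_pos_of_pos hs).ne'
  have hπ := Real.pi_ne_zero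
  rcases eq_or_ne (Real.sin (π * s)) 0 with h0 | h0
  · rw [h0, div_zero, mul_eq_zero, or_iff_right hG] at h
    simp [h, h0]
  · have h1 : Real.Gamma (1 - s) ≠ 0 := by
      intro h1
      rw [h1, mul_zero] at h
      exact div_ne_zero hπ h0 h.symm
    rw [eq_div_iff h0] at h
    rw [div_eq_div_iff h1 hπ]
    linarith

lemma hasSum_mainardi_rayIntegral {α r ψ : ℝ} (hα : 0 < α) (hα1 : α < 1) (hr : 0 < r)
    (h1 : π / 2 < ψ) (h2 : ψ < π + π / 2) :
    HasSum (fun n : ℕ ↦ α / r ^ (α + 1) *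
        ((-(1 / r ^ α)) ^ n / (n.factorial * Real.Gamma (-α * n + 1 - α))))
      ((rayIntegral α r ψ).im / π) := by
  have h := hasSum_rayIntegral_im (r := r) (ρ := r) (ψ := ψ) (κ := π) hα hα1 hr
    (by simp [Complex.exp_pi_mul_I]) (by linarith) (by linarith)
  rw [← hasSum_nat_add_iff' 1] at h
  simp only [Finset.sum_range_one, Nat.cast_zero, mul_zero, zero_add, mul_one, Real.sin_pi,
    sub_zero] at h
  refine (h.div_const π).congr_fun fun n ↦ ?_
  set s : ℝ := α * (n + 1) with hs
  have hspos : 0 < s := by positivity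
  have hcast : α * ((n + 1 : ℕ) : ℝ) = s := by rw [hs]; push_cast; ring
  have hG : -α * n + 1 - α = 1 - s := by rw [hs]; ring
  have hpow : r ^ (-(s + 1)) = (r ^ (α + 1))⁻¹ * ((r ^ α)⁻¹) ^ n := by
    rw [← Real.rpow_neg hr.le, ← Real.rpow_neg hr.le, ← Real.rpow_mul_natCast hr.le,
      ← Real.rpow_add hr, hs]
    ring_nf
  have hrefl := one_div_Gamma_one_sub hspos
  have hsin : Real.sin (π * (s + 1)) = -Real.sin (π * s) := by
    rw [mul_add, mul_one, Real.sin_add_pi]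
  rw [hcast, hG, hpow, hsin, Real.Gamma_add_one hspos.ne', mul_comm (n.factorial : ℝ),
    ← div_div, div_eq_mul_one_div _ (Real.Gamma _), hrefl, neg_pow, Nat.factorial_succ, pow_succ]
  have hn : ((n : ℝ) + 1) ≠ 0 := by positivity
  have hf : (n.factorial : ℝ) ≠ 0 := by positivity
  have hπ := Real.pi_ne_zero
  rw [one_div]
  generalize (r ^ (α + 1)) = A
  generalize ((r ^ α)⁻¹) ^ n = B
  generalize Real.Gamma s = G
  generalize Real.sin (π * s) = S
  rw [hs]
  push_cast
  field_simp

lemma mainardi_eq_rayIntegral {α r ψ : ℝ} (hα : 0 < α) (hα1 : α < 1) (hr : 0 < r)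
    (h1 : π / 2 < ψ) (h2 : ψ < π + π / 2) :
    α / r ^ (α + 1) * mainardi α (1 / r ^ α) = (rayIntegral α r ψ).im / π := by
  rw [mainardi, ← tsum_mul_left]
  exact (hasSum_mainardi_rayIntegral hα hα1 hr h1 h2).tsum_eq

lemma exists_abs_mainardi_le {α : ℝ} (hα : 0 < α) (hα1 : α < 1) :
    ∃ C, ∀ z : ℝ, |z| ≤ 1 → |mainardi α z| ≤ C := by
  have hπ := Real.pi_pos
  have hs := (hasSum_mainardi_rayIntegral hα hα1 one_pos (ψ := π) (by linarith)
    (by linarith)).summable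
  simp only [Real.one_rpow, div_one] at hs
  rw [summable_mul_left_iff hα.ne'] at hs
  refine ⟨_, fun z hz ↦ by
    rw [mainardi, ← Real.norm_eq_abs]
    refine tsum_of_norm_bounded hs.norm.hasSum fun n ↦ ?_
    simp only [norm_div, norm_pow, norm_neg, norm_one, one_pow, Real.norm_eq_abs]
    gcongr
    exact pow_le_one₀ (abs_nonneg _) hz⟩

lemma continuousWithinAt_rayIntegral {α : ℝ} (r : ℝ) (hα : 0 < α) (hα1 : α < 1) :
    ContinuousWithinAt (rayIntegral α r) {ψ | r * Real.cos ψ ≤ 0} (π / 2) := by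
  have hπ := Real.pi_pos
  have hcos : 0 < Real.cos (α * (π / 2)) :=
    Real.cos_pos_of_mem_Ioo ⟨by nlinarith, by nlinarith⟩
  set c := Real.cos (α * (π / 2)) / 2 with hc
  have hc0 : 0 < c := by positivity
  have hcont : Continuous fun v : ℝ ↦ v ^ α := Real.continuous_rpow_const hα.le
  have hnear : ∀ᶠ ψ in 𝓝[{ψ | r * Real.cos ψ ≤ 0}] (π / 2), c < Real.cos (α * ψ) := by
    have : ContinuousAt (fun ψ ↦ Real.cos (α * ψ)) (π / 2) := by fun_prop
    exact nhdsWithin_le_nhds (this.eventually (lt_mem_nhds (by linarith)))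
  refine ContinuousWithinAt.mul (by fun_prop) ?_
  refine continuousWithinAt_of_dominated (bound := fun v ↦ rexp (-c * v ^ α))
    (Eventually.of_forall fun ψ ↦ Continuous.aestronglyMeasurable (by fun_prop)) ?_ ?_
    (ae_of_all _ fun v ↦ by fun_prop)
  · filter_upwards [hnear, self_mem_nhdsWithin] with ψ hψ (hrψ : r * Real.cos ψ ≤ 0)
    refine (ae_restrict_mem measurableSet_Ioi).mono fun v (hv : 0 < v) ↦ ?_
    rw [norm_mul, Complex.norm_exp, Complex.norm_exp, ← Real.exp_add, Real.exp_le_exp]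
    simp only [Complex.neg_re, Complex.re_mul_ofReal, Complex.exp_ofReal_mul_I_re,
      Complex.re_ofReal_mul]
    have h1 := mul_le_mul_of_nonneg_right hψ.le (Real.rpow_nonneg hv.le α)
    have h2 := mul_nonpos_of_nonpos_of_nonneg hrψ hv.le
    linarith
  · simpa [IntegrableOn] using integrableOn_rpow_mul_exp_neg_mul_rpow (s := 0) (by norm_num) hα hc0

lemma mainardi_eq_rayIntegral_pi_div_two {α r : ℝ} (hα : 0 < α) (hα1 : α < 1) (hr : 0 < r) :
    α / r ^ (α + 1) * mainardi α (1 / r ^ α) = (rayIntegral α r (π / 2)).im / π := by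
  have hπ := Real.pi_pos
  have hmem : ∀ᶠ ψ in 𝓝[>] (π / 2), ψ ∈ Ioo (π / 2) (π + π / 2) :=
    Ioo_mem_nhdsGT (by linarith)
  have hle : 𝓝[>] (π / 2) ≤ 𝓝[{ψ | r * Real.cos ψ ≤ 0}] (π / 2) :=
    nhdsWithin_le_of_mem (hmem.mono fun ψ hψ ↦ mul_nonpos_of_nonneg_of_nonpos hr.le
      (Real.cos_nonpos_of_pi_div_two_le_of_le hψ.1.le hψ.2.le))
  have hlim := (continuousWithinAt_rayIntegral r hα hα1).tendsto.mono_left hle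
  have hlim' := ((Complex.continuous_im.tendsto _).comp hlim).div_const π
  refine tendsto_nhds_unique (tendsto_const_nhds.congr' ?_) hlim'
  exact hmem.mono fun ψ hψ ↦ mainardi_eq_rayIntegral hα hα1 hr hψ.1 hψ.2

lemma rayIntegral_pi_div_two_im_of_neg {α r : ℝ} (hα : 0 < α) (hα1 : α < 1) (hr : r < 0) :
    (rayIntegral α r (π / 2)).im = 0 := by
  have hπ := Real.pi_pos
  have hmem : ∀ᶠ ψ in 𝓝[<] (π / 2), ψ ∈ Ioo (-(π / 2)) (π / 2) :=
    Ioo_mem_nhdsLT (by linarith)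
  have hle : 𝓝[<] (π / 2) ≤ 𝓝[{ψ | r * Real.cos ψ ≤ 0}] (π / 2) :=
    nhdsWithin_le_of_mem (hmem.mono fun ψ hψ ↦ mul_nonpos_of_nonpos_of_nonneg hr.le
      (Real.cos_pos_of_mem_Ioo hψ).le)
  have hlim := (continuousWithinAt_rayIntegral r hα hα1).tendsto.mono_left hle
  have hlim' := (Complex.continuous_im.tendsto _).comp hlim
  refine tendsto_nhds_unique hlim' (tendsto_const_nhds.congr' ?_)
  exact hmem.mono fun ψ hψ ↦ (rayIntegral_im_of_neg hα hα1 hr hψ.1 hψ.2).symm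

section Fourier

/-- The restriction of `exp (-z ^ α)` to the imaginary axis. -/
noncomputable def stableCharFun (α v : ℝ) : ℂ := Complex.exp (-((v * Complex.I) ^ (α : ℂ)))

lemma stableCharFun_of_pos {α v : ℝ} (hv : 0 < v) :
    stableCharFun α v =
      Complex.exp (-(Complex.exp ((α * (π / 2) : ℝ) * Complex.I) * (v ^ α : ℝ))) := by
  rw [stableCharFun, Complex.cpow_ofReal, Complex.arg_real_mul _ hv, Complex.arg_I,
    Complex.exp_mul_I, mul_comm α]
  simp [abs_of_pos hv, mul_comm]

lemma stableCharFun_neg (α v : ℝ) :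
    stableCharFun α (-v) = starRingEnd ℂ (stableCharFun α v) := by
  have harg : Complex.arg (v * Complex.I) ≠ π := by
    rw [Ne, Complex.arg_eq_pi_iff]
    simp
  have h := Complex.conj_cpow (v * Complex.I) α harg
  rw [stableCharFun, stableCharFun, ← Complex.exp_conj, map_neg]
  simp only [map_mul, Complex.conj_ofReal, Complex.conj_I] at h
  rw [← h]
  simp

lemma continuous_stableCharFun {α : ℝ} (hα : 0 < α) : Continuous (stableCharFun α) := by
  have h : Continuous fun v : ℝ ↦ ((v : ℂ) * Complex.I) ^ (α : ℂ) :=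
    continuous_iff_continuousAt.2 fun v ↦
      (Complex.continuousAt_cpow_const_of_re_pos (z := v * Complex.I) (Or.inl (by simp))
        (by simpa using hα)).comp (f := fun v : ℝ ↦ (v : ℂ) * Complex.I) (by fun_prop)
  exact Complex.continuous_exp.comp h.neg

lemma integrable_stableCharFun {α : ℝ} (hα : 0 < α) (hα1 : α < 1) :
    Integrable (stableCharFun α) := by
  have hπ := Real.pi_pos
  have hcos : 0 < Real.cos (α * (π / 2)) :=
    Real.cos_pos_of_mem_Ioo ⟨by nlinarith, by nlinarith⟩
  have hpos : IntegrableOn (stableCharFun α) (Ioi 0) := by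
    have h := integrableOn_rpow_mul_exp_neg_mul_rpow (s := 0) (by norm_num) hα hcos
    refine Integrable.congr' h (continuous_stableCharFun hα).aestronglyMeasurable ?_
    refine (ae_restrict_mem measurableSet_Ioi).mono fun v hv ↦ ?_
    rw [stableCharFun_of_pos hv, Complex.norm_exp, Complex.neg_re, Complex.re_mul_ofReal,
      Complex.exp_ofReal_mul_I_re]
    simp
  have hneg : IntegrableOn (stableCharFun α) (Iio 0) := by
    have h := hpos.comp_neg
    rw [Set.neg_Ioi, neg_zero] at h
    refine Integrable.congr' h (continuous_stableCharFun hα).aestronglyMeasurable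
      (ae_of_all _ fun v ↦ ?_)
    rw [stableCharFun_neg, RCLike.norm_conj]
  rw [← integrableOn_univ, ← Iio_union_Ici (a := (0 : ℝ))]
  exact hneg.union ((integrableOn_Ici_iff_integrableOn_Ioi (by simp)).2 hpos)

lemma fourierInv_stableCharFun {α : ℝ} (hα : 0 < α) (hα1 : α < 1) (x : ℝ) :
    𝓕⁻ (stableCharFun α) x = ((2 * (rayIntegral α (2 * π * x) (π / 2)).im : ℝ) : ℂ) := by
  set G : ℝ → ℂ := fun v ↦
    Complex.exp ((2 * π * (v * x) : ℝ) * Complex.I) * stableCharFun α v with hG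
  have hcontG : Continuous G := by
    have := continuous_stableCharFun hα
    fun_prop
  have hGint : Integrable G := by
    refine Integrable.congr' (integrable_stableCharFun hα hα1) hcontG.aestronglyMeasurable
      (ae_of_all _ fun v ↦ ?_)
    rw [norm_mul, Complex.norm_exp_ofReal_mul_I, one_mul]
  have hGneg : ∀ v, G (-v) = starRingEnd ℂ (G v) := fun v ↦ by
    simp only [hG, map_mul, stableCharFun_neg, ← Complex.exp_conj, Complex.conj_ofReal,
      Complex.conj_I]
    congr 2
    push_cast
    ring
  have hInv : 𝓕⁻ (stableCharFun α) x = ∫ v, G v := by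
    rw [Real.fourierInv_eq']
    simp [hG, mul_comm x]
  have hhalf : ∫ v in Iic 0, G v = starRingEnd ℂ (∫ v in Ioi 0, G v) := by
    rw [← integral_conj, ← neg_zero, ← integral_comp_neg_Ioi, neg_zero]
    simp_rw [hGneg]
  have hray : rayIntegral α (2 * π * x) (π / 2) = Complex.I * ∫ v in Ioi 0, G v := by
    have hI : Complex.exp ((π / 2 : ℝ) * Complex.I) = Complex.I := by
      push_cast; exact Complex.exp_pi_div_two_mul_I
    rw [rayIntegral, hI]
    congr 1
    refine setIntegral_congr_fun measurableSet_Ioi fun v hv ↦ ?_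
    simp only [hG]
    rw [stableCharFun_of_pos hv, mul_comm]
    congr 2
    push_cast
    ring
  rw [hInv, ← integral_add_compl measurableSet_Iic hGint, compl_Iic, hhalf, hray, add_comm,
    Complex.add_conj]
  simp

lemma continuous_fourierInv {f : ℝ → ℂ} (hf : Integrable f) : Continuous (𝓕⁻ f) := by
  have h : 𝓕⁻ f = fun x ↦ ∫ v, Complex.exp ((2 * π * (v * x) : ℝ) * Complex.I) * f v := by
    ext x
    rw [Real.fourierInv_eq']
    simp [mul_comm x]
  rw [h]
  refine continuous_of_dominated (bound := fun v ↦ ‖f v‖) (fun x ↦ ?_)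
    (fun x ↦ ae_of_all _ fun v ↦ ?_) hf.norm (ae_of_all _ fun v ↦ by fun_prop)
  · exact (Continuous.aestronglyMeasurable (by fun_prop)).mul hf.aestronglyMeasurable
  · rw [norm_mul, Complex.norm_exp_ofReal_mul_I, one_mul]


/-- The Fourier inverse of `stableCharFun`, in the normalisation of characteristic functions. -/
noncomputable def stableDensity (α r : ℝ) : ℂ := 𝓕⁻ (stableCharFun α) (r / (2 * π)) / (2 * π)

lemma stableDensity_of_pos {α r : ℝ} (hα : 0 < α) (hα1 : α < 1) (hr : 0 < r) :
    stableDensity α r = ((α / r ^ (α + 1) * mainardi α (1 / r ^ α) : ℝ) : ℂ) := by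
  have hπ := Real.pi_ne_zero
  have hπ' : (π : ℂ) ≠ 0 := Complex.ofReal_ne_zero.2 hπ
  rw [stableDensity, fourierInv_stableCharFun hα hα1, mul_div_cancel₀ _ (by positivity),
    mainardi_eq_rayIntegral_pi_div_two hα hα1 hr]
  push_cast
  field_simp

lemma stableDensity_of_neg {α r : ℝ} (hα : 0 < α) (hα1 : α < 1) (hr : r < 0) :
    stableDensity α r = 0 := by
  rw [stableDensity, fourierInv_stableCharFun hα hα1, mul_div_cancel₀ _ (by positivity),
    rayIntegral_pi_div_two_im_of_neg hα hα1 hr]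
  simp

lemma continuous_stableDensity {α : ℝ} (hα : 0 < α) (hα1 : α < 1) :
    Continuous (stableDensity α) := by
  have h := continuous_fourierInv (integrable_stableCharFun hα hα1)
  unfold stableDensity
  fun_prop

lemma integrable_stableDensity {α : ℝ} (hα : 0 < α) (hα1 : α < 1) :
    Integrable (stableDensity α) := by
  have hcont := continuous_stableDensity hα hα1
  have hneg : IntegrableOn (stableDensity α) (Iio 0) :=
    integrableOn_zero.congr_fun (fun r hr ↦ (stableDensity_of_neg hα hα1 hr).symm)
      measurableSet_Iio
  have hmid : IntegrableOn (stableDensity α) (Icc 0 1) :=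
    hcont.continuousOn.integrableOn_Icc
  have htail : IntegrableOn (stableDensity α) (Ioi 1) := by
    obtain ⟨C, hC⟩ := exists_abs_mainardi_le hα hα1
    have h := (integrableOn_Ioi_rpow_of_lt (a := -(α + 1)) (by linarith) one_pos).const_mul (α * C)
    refine Integrable.mono' h hcont.aestronglyMeasurable ?_
    refine (ae_restrict_mem measurableSet_Ioi).mono fun r (hr : 1 < r) ↦ ?_
    have hr0 : 0 < r := one_pos.trans hr
    have hz : |1 / r ^ α| ≤ 1 := by
      rw [abs_of_pos (by positivity), div_le_one (by positivity)]
      exact Real.one_le_rpow hr.le hα.le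
    rw [stableDensity_of_pos hα hα1 hr0, Complex.norm_real, norm_mul, Real.norm_eq_abs,
      Real.norm_eq_abs, abs_of_pos (by positivity), Real.rpow_neg hr0.le, div_eq_mul_inv,
      mul_right_comm]
    gcongr
    exact hC _ hz
  rw [← integrableOn_univ, ← Iio_union_Ici (a := (0 : ℝ)),
    ← Icc_union_Ioi_eq_Ici (zero_le_one' ℝ)]
  exact hneg.union (hmid.union htail)

lemma integral_stableDensity_mul_exp_I {α : ℝ} (hα : 0 < α) (hα1 : α < 1) (y : ℝ) :
    ∫ r in Ioi (0 : ℝ), stableDensity α r * Complex.exp (-((y * Complex.I) * r)) =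
      stableCharFun α y := by
  have hπ : (0 : ℝ) < 2 * π := by positivity
  have hπ' : (π : ℂ) ≠ 0 := Complex.ofReal_ne_zero.2 Real.pi_ne_zero
  have hInv : ∀ x, 𝓕⁻ (stableCharFun α) x = 2 * π * stableDensity α (2 * π * x) := fun x ↦ by
    rw [stableDensity, mul_div_cancel_left₀ _ hπ.ne']
    field_simp
  have hint : Integrable (𝓕⁻ (stableCharFun α)) := by
    rw [funext hInv]
    exact ((integrable_stableDensity hα hα1).comp_mul_left' hπ.ne').const_mul _
  have hint' : Integrable (𝓕 (stableCharFun α)) := by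
    refine hint.comp_neg.congr (ae_of_all _ fun x ↦ ?_)
    simp [Real.fourierInv_eq_fourier_neg]
  have hset : ∫ r in Ioi (0 : ℝ), stableDensity α r * Complex.exp (-((y * Complex.I) * r)) =
      ∫ r : ℝ, stableDensity α r * Complex.exp (-((y * Complex.I) * r)) := by
    refine setIntegral_eq_integral_of_ae_compl_eq_zero ?_
    filter_upwards [Measure.ae_ne volume (0 : ℝ)] with r hr hr'
    rw [stableDensity_of_neg hα hα1 (lt_of_le_of_ne (not_lt.1 hr') hr), zero_mul]
  rw [hset, ← (continuous_stableCharFun hα).fourier_fourierInv_eq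
    (integrable_stableCharFun hα hα1) hint', Real.fourier_real_eq_integral_exp_smul]
  have hsub := Measure.integral_comp_mul_left
    (fun r : ℝ ↦ stableDensity α r * Complex.exp (-((y * Complex.I) * r))) (2 * π)
  have hcancel : ∫ r : ℝ, stableDensity α r * Complex.exp (-((y * Complex.I) * r)) =
      (2 * π : ℂ) * ∫ x : ℝ, stableDensity α (2 * π * x) *
        Complex.exp (-((y * Complex.I) * (2 * π * x : ℝ))) := by
    rw [hsub, abs_of_pos (inv_pos.2 hπ), Complex.real_smul]
    push_cast
    field_simp
  rw [hcancel, ← integral_const_mul]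
  refine integral_congr_ae (ae_of_all _ fun x ↦ ?_)
  simp only [hInv, smul_eq_mul]
  rw [mul_comm (Complex.exp _), ← mul_assoc]
  congr 2
  push_cast
  ring

end Fourier

section HalfPlane

lemma norm_exp_neg_cpow_le_one {α : ℝ} (hα : 0 < α) (hα1 : α < 1) {z : ℂ} (hz : 0 ≤ z.re) :
    ‖Complex.exp (-(z ^ (α : ℂ)))‖ ≤ 1 := by
  rw [Complex.norm_exp, Complex.neg_re, Complex.cpow_ofReal_re, Real.exp_le_one_iff,
    Left.neg_nonpos_iff]
  have hπ := Real.pi_pos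
  have h := abs_le.1 (Complex.abs_arg_le_pi_div_two_iff.2 hz)
  refine mul_nonneg (Real.rpow_nonneg (norm_nonneg _) _)
    (Real.cos_nonneg_of_neg_pi_div_two_le_of_le ?_ ?_)
  · nlinarith
  · nlinarith

lemma norm_mul_exp_neg_le {z : ℂ} (hz : 0 ≤ z.re) {r : ℝ} (hr : 0 ≤ r) (a : ℂ) :
    ‖a * Complex.exp (-(z * r))‖ ≤ ‖a‖ := by
  rw [norm_mul, Complex.norm_exp, Complex.neg_re, Complex.re_mul_ofReal]
  refine mul_le_of_le_one_right (norm_nonneg _) (Real.exp_le_one_iff.2 ?_)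
  have := mul_nonneg hz hr
  linarith

theorem integral_stableDensity_mul_exp {α : ℝ} (hα : 0 < α) (hα1 : α < 1) {z : ℂ}
    (hz : 0 ≤ z.re) :
    ∫ r in Ioi (0 : ℝ), stableDensity α r * Complex.exp (-(z * r)) =
      Complex.exp (-(z ^ (α : ℂ))) := by
  have hint : IntegrableOn (stableDensity α) (Ioi 0) := (integrable_stableDensity hα hα1).integrableOn
  have hcont := continuous_stableDensity hα hα1
  set F : ℂ → ℂ := fun z ↦ (∫ r in Ioi (0 : ℝ), stableDensity α r * Complex.exp (-(z * r))) -
    Complex.exp (-(z ^ (α : ℂ))) with hF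
  set C : ℝ := (∫ r in Ioi (0 : ℝ), ‖stableDensity α r‖) + 1
  have hbound : ∀ z : ℂ, 0 ≤ z.re → ‖F z‖ ≤ C := fun z hz ↦ by
    refine (norm_sub_le _ _).trans (add_le_add ?_ (norm_exp_neg_cpow_le_one hα hα1 hz))
    refine norm_integral_le_of_norm_le hint.norm ?_
    exact (ae_restrict_mem measurableSet_Ioi).mono fun r (hr : 0 < r) ↦
      norm_mul_exp_neg_le hz hr.le _
  have hd : DiffContOnCl ℂ F {z | 0 < z.re} := by
    refine ⟨DifferentiableOn.sub (differentiableOn_integral_mul_exp_neg fun ε hε ↦ ?_) ?_, ?_⟩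
    · refine Integrable.mono' hint.norm (Continuous.aestronglyMeasurable (by fun_prop)) ?_
      refine (ae_restrict_mem measurableSet_Ioi).mono fun r (hr : 0 < r) ↦ ?_
      have := norm_mul_exp_neg_le (z := ε) (by simpa using hε.le) hr.le (stableDensity α r)
      simpa using this
    · intro z (hz : 0 < z.re)
      exact ((differentiableAt_id.cpow_const (Or.inl hz)).neg.cexp).differentiableWithinAt
    · rw [Complex.closure_setOfPred_lt_re]
      refine ContinuousOn.sub ?_ ?_
      · refine continuousOn_of_dominated (bound := fun r ↦ ‖stableDensity α r‖)
          (fun z _ ↦ Continuous.aestronglyMeasurable (by fun_prop)) (fun z hz ↦ ?_) hint.norm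
          (ae_of_all _ fun r ↦ by fun_prop)
        exact (ae_restrict_mem measurableSet_Ioi).mono fun r (hr : 0 < r) ↦
          norm_mul_exp_neg_le hz hr.le _
      · intro z hz
        exact ((Complex.continuousAt_cpow_const_of_re_pos (Or.inl hz)
          (by simpa using hα)).neg.cexp).continuousWithinAt
  have hzero : ‖F z‖ ≤ 0 := by
    refine PhragmenLindelof.right_half_plane_of_bounded_on_real hd ⟨0, two_pos, 0, ?_⟩ ?_ ?_ hz
    · refine IsBigO.of_bound C (eventually_inf_principal.2 (Eventually.of_forall fun z hz ↦ ?_))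
      simpa using hbound z (le_of_lt hz)
    · exact isBoundedUnder_of_eventually_le (a := C)
        ((eventually_ge_atTop 0).mono fun x hx ↦ hbound x (by simpa using hx))
    · intro y
      simp only [hF]
      rw [integral_stableDensity_mul_exp_I hα hα1, stableCharFun, sub_self, norm_zero]
  exact sub_eq_zero.1 (norm_le_zero_iff.1 hzero)

end HalfPlane

theorem mainardi_stable_density (α lam : ℝ) (hα : α ∈ Set.Ioo (0 : ℝ) 1) (hlam : 0 ≤ lam) :
    ∫ r in Set.Ioi (0 : ℝ),
      (α / r ^ (α + 1)) * mainardi α (1 / r ^ α) * Real.exp (-lam * r) =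
        Real.exp (-lam ^ α) := by
  have h := integral_stableDensity_mul_exp hα.1 hα.2 (z := lam) (by simpa using hlam)
  rw [← Complex.ofReal_inj, ← integral_complex_ofReal, Complex.ofReal_exp, Complex.ofReal_neg,
    Complex.ofReal_cpow hlam, ← h]
  refine setIntegral_congr_fun measurableSet_Ioi fun r hr ↦ ?_
  simp only [stableDensity_of_pos hα.1 hα.2 hr]
  push_cast
  ring_nf
end
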